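/- arXiv:2406.09107 — 2 statements merged into one kernel-verified Lean document; each statement's English description precedes it below -/
import Mathlib

section
/- The point set P = { (√(n/π) cos(2π√n), √(n/π) sin(2π√n)) : n ∈ ℕ } has uniform asymptotic density one: for any bounded measurable A ⊂ ℝ² whose boundary has Lebesgue measure zero, #(P ∩ T·A)/T² → vol(A) as T → ∞. -/
open Real MeasureTheory Pointwise

/-- The spiral point set `P = { (√(n/π) cos(2π√n), √(n/π) sin(2π√n)) : n ∈ ℕ }`. -/
noncomputable def spiralSet : Set (ℝ × ℝ) :=
  {p | ∃ n : ℕ, 0 < n ∧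
    p = (Real.sqrt (n / π) * Real.cos (2 * π * Real.sqrt n),
         Real.sqrt (n / π) * Real.sin (2 * π * Real.sqrt n))}


open Set Filter Topology

noncomputable def spK (n : ℕ) : ℝ := (Nat.sqrt n : ℝ)
noncomputable def spJ (n : ℕ) : ℝ := (n : ℝ) - spK n ^ 2

noncomputable def spRect (n : ℕ) : Set (ℝ × ℝ) :=
  Set.Ico (spK n / √π) ((spK n + 1) / √π) ×ˢ
    Set.Ioc (-π + 2 * π * (spJ n / (2 * spK n + 1))) (-π + 2 * π * ((spJ n + 1) / (2 * spK n + 1)))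

noncomputable def spCell (n : ℕ) : Set (ℝ × ℝ) := polarCoord ⁻¹' spRect n

noncomputable def spZ (n : ℕ) : ℝ × ℝ :=
  (Real.sqrt (n / π) * Real.cos (2 * π * Real.sqrt n),
         Real.sqrt (n / π) * Real.sin (2 * π * Real.sqrt n))

lemma spK_nonneg (n : ℕ) : 0 ≤ spK n := by unfold spK; positivity

lemma spJ_nonneg (n : ℕ) : 0 ≤ spJ n := by
  unfold spJ spK
  have := Nat.sqrt_le' n
  have : ((Nat.sqrt n : ℝ)) ^ 2 ≤ n := by exact_mod_cast this
  linarith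

lemma spJ_le (n : ℕ) : spJ n ≤ 2 * spK n := by
  unfold spJ spK
  have := Nat.lt_succ_sqrt' n
  have : n + 1 ≤ (Nat.sqrt n + 1) ^ 2 := this
  have : (n : ℝ) + 1 ≤ ((Nat.sqrt n : ℝ) + 1) ^ 2 := by exact_mod_cast this
  nlinarith

lemma spJ_cast (n : ℕ) : spJ n = ((n - Nat.sqrt n ^ 2 : ℕ) : ℝ) := by
  rw [Nat.cast_sub (Nat.sqrt_le' n)]; simp [spJ, spK]

lemma spRect_disj {n m : ℕ} {p : ℝ × ℝ} (hn : p ∈ spRect n) (hm : p ∈ spRect m) : n = m := by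
  have hpi : 0 < √π := Real.sqrt_pos.2 Real.pi_pos
  have hpp := Real.pi_pos
  obtain ⟨⟨a1, a2⟩, a3, a4⟩ := hn
  obtain ⟨⟨b1, b2⟩, b3, b4⟩ := hm
  have h1 : spK n < spK m + 1 := (div_lt_div_iff_of_pos_right hpi).1 (a1.trans_lt b2)
  have h2 : spK m < spK n + 1 := (div_lt_div_iff_of_pos_right hpi).1 (b1.trans_lt a2)
  have hk : Nat.sqrt n = Nat.sqrt m := by
    unfold spK at h1 h2
    have h1' : Nat.sqrt n < Nat.sqrt m + 1 := by exact_mod_cast h1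
    have h2' : Nat.sqrt m < Nat.sqrt n + 1 := by exact_mod_cast h2
    omega
  have hkk : spK n = spK m := by unfold spK; rw [hk]
  rw [hkk] at a3 a4
  have hk0 : 0 < 2 * spK m + 1 := by have := spK_nonneg m; linarith
  have g1 : spJ n < spJ m + 1 := by
    have := a3.trans_le b4
    have := lt_of_mul_lt_mul_left (lt_of_add_lt_add_left this) (by positivity)
    exact (div_lt_div_iff_of_pos_right hk0).1 this
  have g2 : spJ m < spJ n + 1 := by
    have := b3.trans_le a4
    have := lt_of_mul_lt_mul_left (lt_of_add_lt_add_left this) (by positivity)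
    exact (div_lt_div_iff_of_pos_right hk0).1 this
  unfold spJ at g1 g2
  rw [hkk] at g1 g2
  have h1' : n < m + 1 := by
    have : (n : ℝ) < m + 1 := by linarith
    exact_mod_cast this
  have h2' : m < n + 1 := by
    have : (m : ℝ) < n + 1 := by linarith
    exact_mod_cast this
  omega

lemma spRect_cover (p : ℝ × ℝ) (h1 : 0 ≤ p.1) (h2 : -π < p.2) (h3 : p.2 ≤ π) :
    ∃ n, p ∈ spRect n := by
  have hpi : 0 < √π := Real.sqrt_pos.2 Real.pi_pos
  have hpp := Real.pi_pos
  set k := ⌊p.1 * √π⌋₊ with hk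
  have k1 : (k : ℝ) ≤ p.1 * √π := Nat.floor_le (by positivity)
  have k2 : p.1 * √π < k + 1 := Nat.lt_floor_add_one _
  set t : ℝ := (p.2 + π) / (2 * π) * (2 * k + 1) with ht
  have t0 : 0 < t := by
    have : 0 < p.2 + π := by linarith
    positivity
  have t1 : t ≤ 2 * k + 1 := by
    have : (p.2 + π) / (2 * π) ≤ 1 := by rw [div_le_one (by positivity)]; linarith
    have h0 : (0 : ℝ) ≤ 2 * k + 1 := by positivity
    nlinarith
  have hc0 : 0 < ⌈t⌉₊ := Nat.ceil_pos.2 t0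
  have hc1 : ⌈t⌉₊ ≤ 2 * k + 1 := Nat.ceil_le.2 (by exact_mod_cast t1)
  obtain ⟨j, hj⟩ : ∃ j, ⌈t⌉₊ = j + 1 := ⟨⌈t⌉₊ - 1, by omega⟩
  have j1 : (j : ℝ) < t := Nat.lt_ceil.1 (by omega)
  have j2 : t ≤ j + 1 := by have := Nat.le_ceil t; rw [hj] at this; exact_mod_cast this
  have hs : Nat.sqrt (k ^ 2 + j) = k := by
    symm; rw [Nat.eq_sqrt']
    constructor
    · omega
    · have : j ≤ 2 * k := by omega
      nlinarith
  refine ⟨k ^ 2 + j, ?_⟩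
  have hK : spK (k ^ 2 + j) = k := by unfold spK; rw [hs]
  have hJ : spJ (k ^ 2 + j) = j := by unfold spJ; rw [hK]; push_cast; ring
  have hq : (0 : ℝ) < 2 * k + 1 := by positivity
  have hp2 : p.2 = -π + 2 * π * (t / (2 * k + 1)) := by
    rw [ht]; field_simp; ring
  unfold spRect
  rw [hK, hJ]
  refine ⟨⟨?_, ?_⟩, ?_, ?_⟩
  · rwa [div_le_iff₀ hpi]
  · rwa [lt_div_iff₀ hpi]
  · rw [hp2]; gcongr
  · rw [hp2]; gcongr

lemma polarCoord_eq (x : ℝ × ℝ) : x = ((polarCoord x).1 * cos (polarCoord x).2,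
    (polarCoord x).1 * sin (polarCoord x).2) := by
  have h : (polarCoord x).1 = ‖Complex.equivRealProd.symm x‖ := by
    rw [polarCoord_apply]
    simp [Complex.norm_def, Complex.normSq_apply, pow_two]
  have h2 : (polarCoord x).2 = Complex.arg (Complex.equivRealProd.symm x) := rfl
  rw [h, h2, Complex.norm_mul_cos_arg, Complex.norm_mul_sin_arg]
  simp

lemma spCell_cover (x : ℝ × ℝ) : ∃ n, x ∈ spCell n := by
  apply spRect_cover
  · rw [polarCoord_apply]; positivity
  · exact Complex.neg_pi_lt_arg _
  · exact Complex.arg_le_pi _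

lemma spRect_meas (n : ℕ) : MeasurableSet (spRect n) := measurableSet_Ico.prod measurableSet_Ioc

lemma spCell_meas (n : ℕ) : MeasurableSet (spCell n) := by
  have : Measurable (polarCoord : ℝ × ℝ → ℝ × ℝ) := by
    change Measurable (fun q : ℝ × ℝ => (√(q.1 ^ 2 + q.2 ^ 2), Complex.arg (Complex.equivRealProd.symm q)))
    refine Measurable.prodMk (by fun_prop) ?_
    exact Complex.measurable_arg.comp Complex.measurableEquivRealProd.symm.measurable
  exact this (spRect_meas n)

lemma spCell_vol (n : ℕ) : volume (spCell n) = 1 := by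
  have hpi : 0 < √π := Real.sqrt_pos.2 Real.pi_pos
  have hpp := Real.pi_pos
  have hk := spK_nonneg n
  have hj := spJ_nonneg n
  have hj2 := spJ_le n
  have hq : (0 : ℝ) < 2 * spK n + 1 := by positivity
  rw [← lintegral_indicator_one (spCell_meas n), ← lintegral_comp_polarCoord_symm]
  have e1 : ∫⁻ (p : ℝ × ℝ) in polarCoord.target,
      ENNReal.ofReal p.1 • (spCell n).indicator 1 (polarCoord.symm p)
      = ∫⁻ (p : ℝ × ℝ) in polarCoord.target, (spRect n).indicator (fun p => ENNReal.ofReal p.1) p := by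
    refine setLIntegral_congr_fun polarCoord.open_target.measurableSet ?_
    intro p hp
    have : polarCoord.symm p ∈ spCell n ↔ p ∈ spRect n := by
      unfold spCell
      rw [mem_preimage, polarCoord.right_inv hp]
    by_cases h : p ∈ spRect n
    · have h' := this.2 h
      simp only [Set.indicator_of_mem h, Set.indicator_of_mem h']
      simp
    · have h' := fun q => h (this.1 q)
      simp only [Set.indicator_of_notMem h, Set.indicator_of_notMem h']
      simp
  rw [e1, lintegral_indicator (spRect_meas n), Measure.restrict_restrict (spRect_meas n)]
  have e2 : (spRect n ∩ polarCoord.target : Set (ℝ × ℝ)) =ᵐ[volume] (spRect n : Set (ℝ × ℝ)) := by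
    unfold spRect
    rw [polarCoord_target, Set.prod_inter_prod]
    refine Measure.set_prod_ae_eq ?_ ?_
    · have : (Ico (spK n / √π) ((spK n + 1) / √π) ∩ Ici 0 : Set ℝ) =
        Ico (spK n / √π) ((spK n + 1) / √π) := by
        apply inter_eq_left.2
        intro x hx
        exact le_trans (by positivity) hx.1
      conv_rhs => rw [← this]
      exact (ae_eq_refl _).inter Ioi_ae_eq_Ici
    · have : (Ioc (-π + 2 * π * (spJ n / (2 * spK n + 1))) (-π + 2 * π * ((spJ n + 1) / (2 * spK n + 1)))
          ∩ Ioc (-π) π : Set ℝ) = Ioc (-π + 2 * π * (spJ n / (2 * spK n + 1))) (-π + 2 * π * ((spJ n + 1) / (2 * spK n + 1))) := by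
        apply inter_eq_left.2
        apply Ioc_subset_Ioc
        · have : 0 ≤ 2 * π * (spJ n / (2 * spK n + 1)) := by positivity
          linarith
        · have : (spJ n + 1) / (2 * spK n + 1) ≤ 1 := by rw [div_le_one hq]; linarith
          nlinarith
      conv_rhs => rw [← this]
      exact (ae_eq_refl _).inter Ioo_ae_eq_Ioc
  rw [setLIntegral_congr e2]
  unfold spRect
  rw [Measure.volume_eq_prod, ← Measure.prod_restrict]
  have := lintegral_prod_mul (μ := volume.restrict (Ico (spK n / √π) ((spK n + 1) / √π)))
    (ν := volume.restrict (Ioc (-π + 2 * π * (spJ n / (2 * spK n + 1))) (-π + 2 * π * ((spJ n + 1) / (2 * spK n + 1)))))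
    (f := fun r => ENNReal.ofReal r) (g := fun _ => 1) (by fun_prop) (by fun_prop)
  simp only [mul_one] at this
  rw [this]
  have hab : spK n / √π ≤ (spK n + 1) / √π := by gcongr; linarith
  rw [lintegral_one, Measure.restrict_apply_univ, Real.volume_Ioc,
    setLIntegral_congr Ico_ae_eq_Ioc, ← ofReal_integral_eq_lintegral_ofReal,
    ← intervalIntegral.integral_of_le hab, integral_id, ← ENNReal.ofReal_mul]
  · rw [← ENNReal.ofReal_one]
    congr 1
    rw [div_pow, div_pow, Real.sq_sqrt hpp.le]
    field_simp
    ring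
  · have : (spK n / √π)^2 ≤ ((spK n + 1) / √π)^2 := by gcongr
    linarith
  · exact (continuous_id.integrableOn_Icc).mono_set Ioc_subset_Icc_self
  · refine (ae_restrict_iff' measurableSet_Ioc).2 (ae_of_all _ fun x hx => ?_)
    exact le_trans (by positivity) hx.1.le

lemma spJ_frac (n : ℕ) : spJ n / (2 * spK n + 1) ≤ √n - spK n ∧
    √n - spK n ≤ (spJ n + 1) / (2 * spK n + 1) ∧ spK n ≤ √n ∧ √n ≤ spK n + 1 := by
  have hk := spK_nonneg n
  have hj := spJ_nonneg n
  have hj2 := spJ_le n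
  have hq : (0 : ℝ) < 2 * spK n + 1 := by positivity
  have hn : √(n : ℝ) ^ 2 = spK n ^ 2 + spJ n := by
    rw [Real.sq_sqrt (by positivity)]; unfold spJ; ring
  have hs : 0 ≤ √(n : ℝ) := by positivity
  have a1 : spK n ≤ √n := abs_le_of_sq_le_sq' (by linarith) hs |>.2
  have a2 : √n ≤ spK n + 1 := abs_le_of_sq_le_sq' (by nlinarith) (by linarith) |>.2
  refine ⟨?_, ?_, a1, a2⟩
  · rw [div_le_iff₀ hq]
    nlinarith
  · have : √n ≤ spK n + (spJ n + 1) / (2 * spK n + 1) := by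
      refine abs_le_of_sq_le_sq' ?_ (by positivity) |>.2
      rw [hn]
      have e : (spK n + (spJ n + 1) / (2 * spK n + 1)) ^ 2 - (spK n ^ 2 + spJ n)
        = ((2 * spK n - spJ n) * (2 * spK n + 1) + (spJ n + 1)^2) / (2 * spK n + 1)^2 := by
        field_simp; ring
      have : 0 ≤ ((2 * spK n - spJ n) * (2 * spK n + 1) + (spJ n + 1)^2) / (2 * spK n + 1)^2 := by
        have : 0 ≤ 2 * spK n - spJ n := by linarith
        positivity
      linarith
    linarith

lemma polar_dist {r s a b C D : ℝ} (hs : 0 ≤ s) (h1 : |r - s| ≤ C) (h2 : s * |a - b| ≤ D) :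
    dist (r * cos a, r * sin a) (s * cos b, s * sin b) ≤ C + D := by
  have key : ∀ u v : ℝ, |u| ≤ 1 → |u - v| ≤ |a - b| → |r * u - s * v| ≤ C + D := by
    intro u v hu huv
    have : r * u - s * v = (r - s) * u + s * (u - v) := by ring
    rw [this]
    refine (abs_add_le _ _).trans ?_
    rw [abs_mul, abs_mul, abs_of_nonneg hs]
    have := mul_le_mul_of_nonneg_left huv hs
    have := mul_le_mul_of_nonneg_left hu (abs_nonneg (r - s))
    linarith
  rw [Prod.dist_eq]
  refine max_le ?_ ?_
  · exact key _ _ (abs_cos_le_one _) (abs_cos_sub_cos_le _ _)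
  · exact key _ _ (abs_sin_le_one _) (abs_sin_sub_sin_le _ _)

lemma spCell_dist {n : ℕ} {x : ℝ × ℝ} (hx : x ∈ spCell n) : dist (-x) (spZ n) ≤ 9 := by
  have hpi : 0 < √π := Real.sqrt_pos.2 Real.pi_pos
  have hpp := Real.pi_pos
  have hk := spK_nonneg n
  have hq : (0 : ℝ) < 2 * spK n + 1 := by positivity
  obtain ⟨f1, f2, f3, f4⟩ := spJ_frac n
  have hx' : polarCoord x ∈ spRect n := hx
  obtain ⟨⟨a1, a2⟩, a3, a4⟩ := hx'
  have hz : spZ n = (√n / √π * cos (2 * π * (√n - spK n)), √n / √π * sin (2 * π * (√n - spK n))) := by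
    have : 2 * π * (√n - spK n) = 2 * π * √n - (Nat.sqrt n : ℕ) * (2 * π) := by unfold spK; ring
    rw [this, Real.cos_sub_nat_mul_two_pi, Real.sin_sub_nat_mul_two_pi, spZ, Real.sqrt_div (by positivity)]
  have hxx : -x = ((polarCoord x).1 * cos ((polarCoord x).2 + π),
    (polarCoord x).1 * sin ((polarCoord x).2 + π)) := by
    conv_lhs => rw [polarCoord_eq x]
    rw [Real.cos_add_pi, Real.sin_add_pi]
    simp
  rw [hz, hxx]
  have s1 : 1 ≤ √π := Real.one_le_sqrt.2 (by linarith [Real.pi_gt_three])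
  have b1 : spK n / √π ≤ √n / √π := by gcongr
  have b2 : √n / √π ≤ (spK n + 1) / √π := by gcongr
  have b3 : (spK n + 1) / √π = spK n / √π + 1 / √π := by ring
  have b4 : 1 / √π ≤ 1 := by rw [div_le_one hpi]; exact s1
  have : (9 : ℝ) = 1 + 8 := by norm_num
  rw [this]
  apply polar_dist (by positivity)
  · rw [abs_le]; constructor <;> linarith
  · have hd : |(polarCoord x).2 + π - 2 * π * (√n - spK n)| ≤ 2 * π / (2 * spK n + 1) := by
      have g1 := mul_le_mul_of_nonneg_left f1 (show 0 ≤ 2 * π by positivity)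
      have g2 := mul_le_mul_of_nonneg_left f2 (show 0 ≤ 2 * π by positivity)
      have g3 : 2 * π * ((spJ n + 1) / (2 * spK n + 1)) =
        2 * π * (spJ n / (2 * spK n + 1)) + 2 * π / (2 * spK n + 1) := by ring
      rw [abs_le]; constructor <;> linarith
    calc _ ≤ (spK n + 1) * (2 * π / (2 * spK n + 1)) := by
          gcongr
          exact b2.trans (div_le_self (by positivity) s1)
      _ ≤ 8 := by
          rw [← mul_div_assoc, div_le_iff₀ hq]
          nlinarith [Real.pi_le_four]

lemma spZ_inj : Function.Injective spZ := by
  have key : ∀ n, (spZ n).1 ^ 2 + (spZ n).2 ^ 2 = n / π := by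
    intro n
    have h1 : √((n : ℝ) / π) ^ 2 = n / π := Real.sq_sqrt (by have := Real.pi_pos; positivity)
    have h2 := Real.sin_sq_add_cos_sq (2 * π * √(n : ℝ))
    simp only [spZ]
    calc _ = √((n : ℝ) / π) ^ 2 * (sin (2 * π * √(n : ℝ)) ^ 2 + cos (2 * π * √(n : ℝ)) ^ 2) := by ring
      _ = _ := by rw [h1, h2, mul_one]
  intro n m h
  have := (key n).symm.trans ((congrArg (fun z : ℝ × ℝ => z.1 ^ 2 + z.2 ^ 2) h).trans (key m))
  rw [div_left_inj' Real.pi_ne_zero] at this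
  exact_mod_cast this

lemma spCells_vol (S : Set ℕ) : volume (⋃ n ∈ S, spCell n) = S.encard := by
  rw [measure_biUnion S.to_countable]
  · simp only [spCell_vol]
    exact ENNReal.tsum_set_one S
  · intro n _ m _ hnm
    refine Set.disjoint_left.2 fun x hx hy => hnm (spRect_disj hx hy)
  · exact fun n _ => spCell_meas n

lemma sp_smul_vol (T : ℝ) (s : Set (ℝ × ℝ)) :
    volume ((-T) • s) = ENNReal.ofReal (T ^ 2) * volume s := by
  rw [Measure.addHaar_smul]
  simp

lemma sp_upper (A : Set (ℝ × ℝ)) {T : ℝ} (hT : 0 < T) :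
    (({n | 0 < n ∧ spZ n ∈ T • A} : Set ℕ).encard : ENNReal) ≤
      ENNReal.ofReal (T ^ 2) * volume (Metric.cthickening (9 / T) A) := by
  rw [← spCells_vol, ← sp_smul_vol]
  refine measure_mono ?_
  intro x hx
  simp only [mem_iUnion] at hx
  obtain ⟨n, ⟨_, a, ha, hz⟩, hx⟩ := hx
  have hd := spCell_dist hx
  refine ⟨(-T)⁻¹ • x, ?_, ?_⟩
  · refine Metric.mem_cthickening_of_dist_le _ a _ _ ha ?_
    have e : (-T)⁻¹ • x = T⁻¹ • (-x) := by rw [inv_neg, neg_smul, smul_neg]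
    have e2 : a = T⁻¹ • spZ n := by rw [← hz]; simp [smul_smul, hT.ne']
    rw [e, e2, dist_smul₀, Real.norm_of_nonneg (by positivity)]
    rw [div_eq_inv_mul]; gcongr
  · simp [smul_smul, hT.ne']

lemma sp_lower (A : Set (ℝ × ℝ)) {T : ℝ} (hT : 0 < T) :
    ENNReal.ofReal (T ^ 2) * volume (Metric.cthickening (9 / T) Aᶜ)ᶜ ≤
    (({n | 0 < n ∧ spZ n ∈ T • A} : Set ℕ).encard : ENNReal) + 1 := by
  have h1 : ((insert 0 {n | 0 < n ∧ spZ n ∈ T • A} : Set ℕ).encard : ENNReal) ≤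
    (({n | 0 < n ∧ spZ n ∈ T • A} : Set ℕ).encard : ENNReal) + 1 := by
    exact_mod_cast Set.encard_insert_le _ _
  refine le_trans ?_ h1
  rw [← spCells_vol, ← sp_smul_vol]
  refine measure_mono ?_
  rintro _ ⟨y, hy, rfl⟩
  obtain ⟨n, hn⟩ := spCell_cover ((-T) • y)
  simp only [mem_iUnion]
  refine ⟨n, ?_, hn⟩
  rcases Nat.eq_zero_or_pos n with h0 | h0
  · left; exact h0
  right
  refine ⟨h0, T⁻¹ • spZ n, ?_, by simp [smul_smul, hT.ne']⟩
  by_contra hA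
  apply hy
  refine Metric.mem_cthickening_of_dist_le _ (T⁻¹ • spZ n) _ _ hA ?_
  have hd := spCell_dist hn
  have e : y = T⁻¹ • (-((-T) • y)) := by simp [smul_smul, hT.ne']
  rw [e, dist_smul₀, Real.norm_of_nonneg (by positivity)]
  rw [div_eq_inv_mul]; gcongr

/-- `P` has uniform asymptotic density one: for any bounded measurable `A ⊂ ℝ²` whose
boundary has Lebesgue measure zero, `#(P ∩ T·A)/T² → vol(A)` as `T → ∞`. -/
theorem stmt4 (A : Set (ℝ × ℝ)) (hbdd : Bornology.IsBounded A) (hmeas : MeasurableSet A)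
    (hbdy : volume (frontier A) = 0) :
    Filter.Tendsto (fun T : ℝ => ((spiralSet ∩ T • A).ncard : ℝ) / T ^ 2)
      Filter.atTop (nhds (volume A).toReal) := by
  have hfin : volume A ≠ ⊤ := hbdd.measure_lt_top.ne
  have hcard : ∀ T : ℝ, ((spiralSet ∩ T • A).ncard : ℝ) =
      (({n | 0 < n ∧ spZ n ∈ T • A} : Set ℕ).encard : ENNReal).toReal := by
    intro T
    have : spiralSet ∩ T • A = Set.image spZ {n | 0 < n ∧ spZ n ∈ T • A} := by
      ext p
      constructor
      · rintro ⟨⟨n, hn, rfl⟩, h⟩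
        exact ⟨n, ⟨hn, h⟩, rfl⟩
      · rintro ⟨n, ⟨hn, h⟩, rfl⟩
        exact ⟨⟨n, hn, rfl⟩, h⟩
    rw [this, Set.ncard_image_of_injective _ spZ_inj, Set.ncard]
    generalize ({n | 0 < n ∧ spZ n ∈ T • A} : Set ℕ).encard = e
    cases e <;> simp
  have hδ : Tendsto (fun T : ℝ => 9 / T) atTop (𝓝 0) := tendsto_const_nhds.div_atTop tendsto_id
  -- upper limit
  have hcl : volume (closure A) = volume A := by
    refine le_antisymm ?_ (measure_mono subset_closure)
    rw [closure_eq_self_union_frontier]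
    exact (measure_union_le _ _).trans (by rw [hbdy, add_zero])
  have hU : Tendsto (fun T : ℝ => (volume (Metric.cthickening (9 / T) A)).toReal) atTop
      (𝓝 (volume A).toReal) := by
    have := (tendsto_measure_cthickening (μ := (volume : Measure (ℝ × ℝ))) (s := A)
      ⟨1, one_pos, hbdd.cthickening.measure_lt_top.ne⟩).comp hδ
    rw [hcl] at this
    exact (ENNReal.tendsto_toReal hfin).comp this
  -- lower limit
  have : IsFiniteMeasure (volume.restrict A) := ⟨by simpa using hbdd.measure_lt_top⟩
  have hL0 : Tendsto (fun T : ℝ => (volume.restrict A (Metric.cthickening (9 / T) Aᶜ)).toReal) atTop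
      (𝓝 0) := by
    have := (tendsto_measure_cthickening (μ := volume.restrict A) (s := Aᶜ)
      ⟨1, one_pos, measure_ne_top _ _⟩).comp hδ
    have h0 : volume.restrict A (closure Aᶜ) = 0 := by
      rw [Measure.restrict_apply isClosed_closure.measurableSet]
      refine measure_mono_null ?_ hbdy
      rintro x ⟨h1, h2⟩
      rw [frontier_eq_closure_inter_closure]
      exact ⟨subset_closure h2, h1⟩
    rw [h0] at this
    exact (ENNReal.tendsto_toReal ENNReal.zero_ne_top).comp this
  have hLeq : ∀ T : ℝ, (volume (Metric.cthickening (9 / T) Aᶜ)ᶜ).toReal =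
      (volume A).toReal - (volume.restrict A (Metric.cthickening (9 / T) Aᶜ)).toReal := by
    intro T
    have hm : MeasurableSet (Metric.cthickening (9 / T) Aᶜ) :=
      Metric.isClosed_cthickening.measurableSet
    have hsub : (Metric.cthickening (9 / T) Aᶜ)ᶜ ⊆ A :=
      Set.compl_subset_comm.1 (Metric.self_subset_cthickening _)
    have e : volume (Metric.cthickening (9 / T) Aᶜ)ᶜ =
        volume.restrict A (Metric.cthickening (9 / T) Aᶜ)ᶜ := by
      rw [Measure.restrict_apply hm.compl, inter_eq_left.2 hsub]
    rw [e]
    have := measureReal_compl (μ := volume.restrict A) hm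
    simpa [Measure.real] using this
  have hinv : Tendsto (fun T : ℝ => 1 / T ^ 2) atTop (𝓝 0) :=
    tendsto_const_nhds.div_atTop (tendsto_pow_atTop two_ne_zero)
  have hL : Tendsto (fun T : ℝ => (volume (Metric.cthickening (9 / T) Aᶜ)ᶜ).toReal - 1 / T ^ 2) atTop
      (𝓝 (volume A).toReal) := by
    simp only [hLeq]
    simpa using (tendsto_const_nhds.sub hL0).sub hinv
  refine tendsto_of_tendsto_of_tendsto_of_le_of_le' hL hU ?_ ?_
  · filter_upwards [eventually_gt_atTop 0] with T hT
    have hT2 : 0 < T ^ 2 := by positivity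
    have hup := sp_upper A hT
    have hEfin : (({n | 0 < n ∧ spZ n ∈ T • A} : Set ℕ).encard : ENNReal) ≠ ⊤ :=
      ne_top_of_le_ne_top (ENNReal.mul_ne_top ENNReal.ofReal_ne_top
        hbdd.cthickening.measure_lt_top.ne) hup
    have := ENNReal.toReal_mono (ENNReal.add_ne_top.2 ⟨hEfin, ENNReal.one_ne_top⟩) (sp_lower A hT)
    rw [ENNReal.toReal_mul, ENNReal.toReal_ofReal hT2.le,
      ENNReal.toReal_add hEfin ENNReal.one_ne_top, ENNReal.toReal_one] at this
    rw [hcard, sub_le_iff_le_add, ← add_div, le_div_iff₀ hT2]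
    linarith
  · filter_upwards [eventually_gt_atTop 0] with T hT
    have hT2 : 0 < T ^ 2 := by positivity
    have := ENNReal.toReal_mono (ENNReal.mul_ne_top ENNReal.ofReal_ne_top
        hbdd.cthickening.measure_lt_top.ne) (sp_upper A hT)
    rw [ENNReal.toReal_mul, ENNReal.toReal_ofReal hT2.le] at this
    rw [hcard, div_le_iff₀ hT2]
    linarith
end

section
/- Siegel integral formula for a shifted lattice: for f ∈ C_c(ℝ²), ∫_{Y₀} Σ_{m∈ℤ²} f((m + (1/2,-1/4))·M) dμ₀(M) = ∫_{ℝ²} f(x) dx, where Y₀ = Γ_{2,0}(4)\SL(2,ℝ) and μ₀ is the SL(2,ℝ)-invariant probability measure on Y₀. -/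
open MeasureTheory
open scoped ENNReal

/-- Membership in the congruence subgroup `Γ_{2,0}(4)` for a real matrix: it is the image
of an integer matrix of determinant one congruent mod 4 to `I` or to `((1,2),(0,1))`. -/
instance : MeasurableSpace (Matrix (Fin 2) (Fin 2) ℝ) := by
  unfold Matrix; infer_instance

def inGamma20 (A : Matrix (Fin 2) (Fin 2) ℝ) : Prop :=
  ∃ γ : Matrix (Fin 2) (Fin 2) ℤ, A = γ.map (Int.cast : ℤ → ℝ) ∧ γ.det = 1 ∧
    (γ.map (Int.cast : ℤ → ZMod 4) = 1 ∨ γ.map (Int.cast : ℤ → ZMod 4) = !![1, 2; 0, 1])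

lemma sg_affine (g : ℝ → ℝ≥0∞) (hg : Measurable g) (a b : ℝ) (hb : b ≠ 0) :
    ∫⁻ t, g (a - t * b) = ENNReal.ofReal |b|⁻¹ * ∫⁻ x, g x := by
  have h1 : ∫⁻ x, g x = ∫⁻ x, g (a - x) := (lintegral_sub_left_eq_self g a).symm
  have h2 := Real.smul_map_volume_mul_left hb
  have h3 : ∫⁻ x, g (a - x) = ENNReal.ofReal |b| * ∫⁻ t, g (a - t * b) := by
    conv_lhs => rw [← h2]
    rw [lintegral_smul_measure, lintegral_map (by fun_prop) (by fun_prop)]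
    simp [mul_comm]
  rw [h1, h3, ← mul_assoc, ← ENNReal.ofReal_mul (by positivity), inv_mul_cancel₀ (by positivity)]
  simp

/-- Unfolding along shears. -/
lemma sg_shear (ν : Measure (Fin 2 → ℝ)) [SFinite ν]
    (hν : ∀ h : Matrix (Fin 2) (Fin 2) ℝ, h.det = 1 → ∀ f : (Fin 2 → ℝ) → ℝ≥0∞, Measurable f →
      ∫⁻ p, f (Matrix.vecMul p h) ∂ν = ∫⁻ p, f p ∂ν)
    (f : (Fin 2 → ℝ) → ℝ≥0∞) (hf : Measurable f) (hf0 : ∀ p, p 1 = 0 → f p = 0) :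
    ∫⁻ p, f p ∂ν = ∫⁻ p, (Set.Ico (0:ℝ) 1).indicator 1 (p 0 / p 1) *
      (ENNReal.ofReal |p 1|⁻¹ * ∫⁻ x, f ![x, p 1]) ∂ν := by
  have hφ : Measurable ((Set.Ico (0:ℝ) 1).indicator (1 : ℝ → ℝ≥0∞)) :=
    measurable_one.indicator measurableSet_Ico
  set φ := (Set.Ico (0:ℝ) 1).indicator (1 : ℝ → ℝ≥0∞) with hφd
  have hφ1 : ∫⁻ t, φ t = 1 := by
    rw [hφd, lintegral_indicator_one measurableSet_Ico]; simp
  have e1 : ∀ p : Fin 2 → ℝ, f p = ∫⁻ t, f p * φ (p 0 / p 1 + t) := by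
    intro p
    rw [lintegral_const_mul _ (by fun_prop), lintegral_add_left_eq_self φ, hφ1, mul_one]
  have e2 : ∀ t : ℝ, ∫⁻ p, f p * φ (p 0 / p 1 + t) ∂ν
      = ∫⁻ p, φ (p 0 / p 1) * f ![p 0 - t * p 1, p 1] ∂ν := by
    intro t
    rw [← hν !![1, 0; -t, 1] (by simp [Matrix.det_fin_two]) (fun p => f p * φ (p 0 / p 1 + t))
      (by fun_prop)]
    apply lintegral_congr
    intro p
    have : Matrix.vecMul p !![1, 0; -t, 1] = ![p 0 - t * p 1, p 1] := by
      ext i; fin_cases i <;> simp [Matrix.vecMul, dotProduct, Fin.sum_univ_two] ; ring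
    simp only [this]
    by_cases hp : p 1 = 0
    · rw [hf0 _ (by simp [hp])]; simp
    · rw [mul_comm]; congr 2
      simp; field_simp; ring
  calc ∫⁻ p, f p ∂ν = ∫⁻ p, (∫⁻ t, f p * φ (p 0 / p 1 + t)) ∂ν := by
        exact lintegral_congr e1
    _ = ∫⁻ t, ∫⁻ p, f p * φ (p 0 / p 1 + t) ∂ν := by
        rw [lintegral_lintegral_swap]
        exact Measurable.aemeasurable (by unfold Function.uncurry; fun_prop)
    _ = ∫⁻ t, ∫⁻ p, φ (p 0 / p 1) * f ![p 0 - t * p 1, p 1] ∂ν := lintegral_congr e2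
    _ = ∫⁻ p, (∫⁻ t, φ (p 0 / p 1) * f ![p 0 - t * p 1, p 1]) ∂ν := by
        rw [lintegral_lintegral_swap]
        refine Measurable.aemeasurable ?_
        unfold Function.uncurry
        have : Measurable fun a : ℝ × (Fin 2 → ℝ) => ![a.2 0 - a.1 * a.2 1, a.2 1] := by
          rw [measurable_pi_iff]; intro i; fin_cases i <;> simp <;> fun_prop
        fun_prop
    _ = _ := by
        apply lintegral_congr
        intro p
        have hm : ∀ c : ℝ, Measurable fun x : ℝ => ![x, c] := by
          intro c
          rw [measurable_pi_iff]; intro i; fin_cases i <;> simp; fun_prop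
        have hm' : Measurable fun x : ℝ => f ![x, p 1] := hf.comp (hm _)
        by_cases hp : p 1 = 0
        · simp [hf0, hp]
        · rw [lintegral_const_mul]
          · rw [sg_affine (fun x => f ![x, p 1]) hm' _ _ hp]
          · exact hm'.comp (by fun_prop)

lemma sg_meas_vec2 (c : ℝ) : Measurable fun x : ℝ => ![x, c] := by
  rw [measurable_pi_iff]; intro i; fin_cases i <;> simp; fun_prop

lemma sg_axis (ν : Measure (Fin 2 → ℝ)) [SFinite ν]
    (hν : ∀ h : Matrix (Fin 2) (Fin 2) ℝ, h.det = 1 → ∀ f : (Fin 2 → ℝ) → ℝ≥0∞, Measurable f →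
      ∫⁻ p, f (Matrix.vecMul p h) ∂ν = ∫⁻ p, f p ∂ν)
    (h0 : ν {0} = 0) : ∀ᵐ p ∂ν, p 1 ≠ 0 := by
  set A : Set (Fin 2 → ℝ) := {p | p 0 = 0 ∧ p 1 ≠ 0} with hA
  have hAm : MeasurableSet A := by
    apply MeasurableSet.inter
    · exact measurableSet_eq_fun (by fun_prop) (by fun_prop)
    · exact (measurableSet_eq_fun (by fun_prop) (by fun_prop)).compl
  have hAi : Measurable (A.indicator (1 : (Fin 2 → ℝ) → ℝ≥0∞)) := measurable_one.indicator hAm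
  have hA0 : ∫⁻ p, A.indicator 1 p ∂ν = 0 := by
    rw [sg_shear ν hν _ hAi]
    · have : ∀ c : ℝ, ∫⁻ x : ℝ, A.indicator (1 : (Fin 2 → ℝ) → ℝ≥0∞) ![x, c] = 0 := by
        intro c
        rw [lintegral_eq_zero_iff (f := fun x => A.indicator 1 ![x, c]) (hAi.comp (sg_meas_vec2 c))]
        have : ∀ᵐ x : ℝ, x ≠ 0 := by simp [ae_iff]
        filter_upwards [this] with x hx
        simp [hA, hx]
      simp [this]
    · intro p hp; simp [hA, hp]
  rw [← hν !![0, 1; -1, 0] (by simp [Matrix.det_fin_two]) _ hAi,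
    lintegral_eq_zero_iff (f := fun p => A.indicator 1 (Matrix.vecMul p !![0, 1; -1, 0])) (hAi.comp (by
      rw [measurable_pi_iff]; intro i
      simp only [Matrix.vecMul, dotProduct]; fun_prop))] at hA0
  have h0' : ∀ᵐ p ∂ν, p ≠ 0 := by simpa [ae_iff] using h0
  filter_upwards [hA0, h0'] with p hp hp0 h1
  apply hp0
  by_contra hne
  have h00 : p 0 ≠ 0 := by
    intro h; apply hne; ext i; fin_cases i <;> simp [h, h1]
  have : Matrix.vecMul p !![0, 1; -1, 0] ∈ A := by
    simp only [hA, Matrix.vecMul, dotProduct, Fin.sum_univ_two, Set.mem_ofPred_eq]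
    simp [h1, h00]
  rw [Set.indicator_of_mem this] at hp
  simp at hp

lemma sg_homog (ν : Measure (Fin 2 → ℝ)) [SFinite ν]
    (hν : ∀ h : Matrix (Fin 2) (Fin 2) ℝ, h.det = 1 → ∀ f : (Fin 2 → ℝ) → ℝ≥0∞, Measurable f →
      ∫⁻ p, f (Matrix.vecMul p h) ∂ν = ∫⁻ p, f p ∂ν)
    (h0 : ν {0} = 0) (f : (Fin 2 → ℝ) → ℝ≥0∞) (hf : Measurable f) (R : ℝ) (hR : 0 < R) :
    ∫⁻ p, f (R⁻¹ • p) ∂ν = ENNReal.ofReal (R ^ 2) * ∫⁻ p, f p ∂ν := by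
  have hax := sg_axis ν hν h0
  set g : (Fin 2 → ℝ) → ℝ≥0∞ := {p : Fin 2 → ℝ | p 1 ≠ 0}.indicator f with hg
  have hgm : Measurable g := hf.indicator
    (measurableSet_eq_fun (by fun_prop) (by fun_prop)).compl
  have hg0 : ∀ p, p 1 = 0 → g p = 0 := by intro p hp; simp [hg, hp]
  have hm : Measurable fun p : Fin 2 → ℝ => ![p 0 / R ^ 2, p 1] := by
    rw [measurable_pi_iff]; intro i; fin_cases i <;> simp <;> fun_prop
  have e1 : ∫⁻ p, f (R⁻¹ • p) ∂ν = ∫⁻ p, g ![p 0 / R ^ 2, p 1] ∂ν := by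
    rw [← hν !![R⁻¹, 0; 0, R] (by simp [Matrix.det_fin_two, hR.ne']) (fun p => f (R⁻¹ • p))
      (by fun_prop)]
    apply lintegral_congr_ae
    filter_upwards [hax] with p hp
    have : R⁻¹ • Matrix.vecMul p !![R⁻¹, 0; 0, R] = ![p 0 / R ^ 2, p 1] := by
      ext i; fin_cases i <;> simp <;> field_simp <;> rfl
    rw [this]; simp [hg, hp]
  have e2 : ∫⁻ p, f p ∂ν = ∫⁻ p, g p ∂ν := by
    apply lintegral_congr_ae
    filter_upwards [hax] with p hp
    simp [hg, hp]
  rw [e1, e2, sg_shear ν hν g hgm hg0,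
    sg_shear ν hν (fun p => g ![p 0 / R ^ 2, p 1]) (hgm.comp hm) (by
      intro p hp; apply hg0; simp [hp]), ← lintegral_const_mul']
  · apply lintegral_congr
    intro p
    have := sg_affine (fun x => g ![x, p 1]) (hgm.comp (sg_meas_vec2 _)) 0 (-(R ^ 2)⁻¹)
      (by simp [hR.ne'])
    have h2 : ∫⁻ x : ℝ, g ![x / R ^ 2, p 1] = ENNReal.ofReal (R ^ 2) * ∫⁻ x : ℝ, g ![x, p 1] := by
      convert this using 3
      · simp [div_eq_mul_inv]
      · simp
    simp only [Matrix.cons_val_zero, Matrix.cons_val_one]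
    rw [h2]; ring
  · simp

/-- The Siegel transform of `g` over the countable set `S`. -/
noncomputable def sgTheta (S : Set (Fin 2 → ℝ)) (g : (Fin 2 → ℝ) → ℝ≥0∞)
    (M : Matrix (Fin 2) (Fin 2) ℝ) : ℝ≥0∞ := ∑' w : S, g (Matrix.vecMul w M)

lemma sg_meas_entry (i j : Fin 2) : Measurable fun M : Matrix (Fin 2) (Fin 2) ℝ => M i j :=
  (measurable_pi_apply j).comp (measurable_pi_apply (X := fun _ : Fin 2 => Fin 2 → ℝ) i)

lemma sg_meas_vecMul (w : Fin 2 → ℝ) :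
    Measurable fun M : Matrix (Fin 2) (Fin 2) ℝ => Matrix.vecMul w M := by
  rw [measurable_pi_iff]; intro j
  simp only [Matrix.vecMul, dotProduct, Fin.sum_univ_two]
  exact ((sg_meas_entry 0 j).const_mul _).add ((sg_meas_entry 1 j).const_mul _)

lemma sgTheta_meas (S : Set (Fin 2 → ℝ)) (hS : S.Countable) (g : (Fin 2 → ℝ) → ℝ≥0∞)
    (hg : Measurable g) : Measurable (sgTheta S g) := by
  have := hS.to_subtype
  unfold sgTheta
  exact Measurable.tsum fun w => hg.comp (sg_meas_vecMul w)

lemma inGamma20_inv (γ : Matrix (Fin 2) (Fin 2) ℝ) (h : inGamma20 γ) :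
    ∃ γ', inGamma20 γ' ∧ γ * γ' = 1 ∧ γ' * γ = 1 := by
  obtain ⟨a, rfl, hd, hm⟩ := h
  have hmm : ∀ b c : Matrix (Fin 2) (Fin 2) ℤ, b * c = 1 →
      b.map (Int.cast : ℤ → ℝ) * c.map (Int.cast : ℤ → ℝ) = 1 := by
    intro b c hbc
    have h1 := Matrix.map_mul (L := b) (M := c) (f := Int.castRingHom ℝ)
    rw [hbc] at h1
    simpa using h1.symm
  refine ⟨a.adjugate.map (Int.cast : ℤ → ℝ), ⟨a.adjugate, rfl, ?_, ?_⟩, ?_, ?_⟩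
  · rw [Matrix.det_adjugate, hd]; simp
  · have e : a.adjugate.map (Int.cast : ℤ → ZMod 4) = (a.map (Int.cast : ℤ → ZMod 4)).adjugate := by
      ext i j; fin_cases i <;> fin_cases j <;> simp [Matrix.adjugate_fin_two]
    rw [e]
    rcases hm with h | h
    · left; rw [h]; simp
    · right; rw [h, Matrix.adjugate_fin_two]; decide
  · exact hmm _ _ (by rw [Matrix.mul_adjugate, hd, one_smul])
  · exact hmm _ _ (by rw [Matrix.adjugate_mul, hd, one_smul])

lemma sgTheta_inv (S : Set (Fin 2 → ℝ)) (g : (Fin 2 → ℝ) → ℝ≥0∞)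
    (hS : ∀ γ, inGamma20 γ → ∀ w ∈ S, Matrix.vecMul w γ ∈ S)
    (γ : Matrix (Fin 2) (Fin 2) ℝ) (hγ : inGamma20 γ) (M : Matrix (Fin 2) (Fin 2) ℝ) :
    sgTheta S g (γ * M) = sgTheta S g M := by
  obtain ⟨γ', h', h1, h2⟩ := inGamma20_inv γ hγ
  let e : S ≃ S :=
    { toFun := fun w => ⟨Matrix.vecMul w γ, hS γ hγ w w.2⟩
      invFun := fun w => ⟨Matrix.vecMul w γ', hS γ' h' w w.2⟩
      left_inv := fun w => by ext1; simp [Matrix.vecMul_vecMul, h1]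
      right_inv := fun w => by ext1; simp [Matrix.vecMul_vecMul, h2] }
  unfold sgTheta
  rw [← e.tsum_eq (fun w : S => g (Matrix.vecMul w M))]
  simp [e, Matrix.vecMul_vecMul]

lemma sgTheta_homog (μ₀ : Measure (Matrix (Fin 2) (Fin 2) ℝ)) [IsProbabilityMeasure μ₀]
    (hdet : ∀ᵐ M ∂μ₀, M.det = 1)
    (hinv : ∀ h : Matrix (Fin 2) (Fin 2) ℝ, h.det = 1 →
      ∀ F : Matrix (Fin 2) (Fin 2) ℝ → ℝ≥0∞, Measurable F →
        (∀ γ, inGamma20 γ → ∀ M, F (γ * M) = F M) →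
        ∫⁻ M, F (M * h) ∂μ₀ = ∫⁻ M, F M ∂μ₀)
    (S : Set (Fin 2 → ℝ)) (hc : S.Countable) (hS0 : (0 : Fin 2 → ℝ) ∉ S)
    (hS : ∀ γ, inGamma20 γ → ∀ w ∈ S, Matrix.vecMul w γ ∈ S)
    (g : (Fin 2 → ℝ) → ℝ≥0∞) (hg : Measurable g) (R : ℝ) (hR : 0 < R) :
    ∫⁻ M, sgTheta S (fun p => g (R⁻¹ • p)) M ∂μ₀
      = ENNReal.ofReal (R ^ 2) * ∫⁻ M, sgTheta S g M ∂μ₀ := by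
  have := hc.to_subtype
  let ν : Measure (Fin 2 → ℝ) :=
    Measure.sum fun w : S => μ₀.map (fun M => Matrix.vecMul (w : Fin 2 → ℝ) M)
  have key : ∀ f : (Fin 2 → ℝ) → ℝ≥0∞, Measurable f →
      ∫⁻ p, f p ∂ν = ∫⁻ M, sgTheta S f M ∂μ₀ := by
    intro f hf
    unfold sgTheta
    rw [lintegral_sum_measure, lintegral_tsum]
    · congr 1; ext w
      rw [lintegral_map hf (sg_meas_vecMul w)]
    · intro w; exact (hf.comp (sg_meas_vecMul w)).aemeasurable
  have hmv : ∀ h : Matrix (Fin 2) (Fin 2) ℝ, Measurable fun p => Matrix.vecMul p h := by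
    intro h
    rw [measurable_pi_iff]; intro i
    simp only [Matrix.vecMul, dotProduct]; fun_prop
  have : SFinite ν := inferInstance
  have h0 : ν {0} = 0 := by
    rw [Measure.sum_apply _ (measurableSet_singleton _), ENNReal.tsum_eq_zero]
    intro w
    rw [Measure.map_apply (sg_meas_vecMul w) (measurableSet_singleton _)]
    refine measure_mono_null ?_ (ae_iff.mp hdet)
    intro M hM hd
    apply hS0
    have : (w : Fin 2 → ℝ) = 0 := by
      have h1 : IsUnit M.det := by rw [hd]; exact isUnit_one
      have h2 := congrArg (fun p => Matrix.vecMul p M⁻¹) hM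
      simpa [Matrix.vecMul_vecMul, Matrix.mul_nonsing_inv M h1] using h2
    rw [← this]; exact w.2
  have hν : ∀ h : Matrix (Fin 2) (Fin 2) ℝ, h.det = 1 → ∀ f : (Fin 2 → ℝ) → ℝ≥0∞, Measurable f →
      ∫⁻ p, f (Matrix.vecMul p h) ∂ν = ∫⁻ p, f p ∂ν := by
    intro h hh f hf
    rw [key f hf, key (fun p => f (Matrix.vecMul p h)) (hf.comp (hmv h)),
      ← hinv h hh _ (sgTheta_meas S hc f hf) (sgTheta_inv S f hS)]
    simp [sgTheta, Matrix.vecMul_vecMul]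
  rw [← key g hg, ← key _ (by fun_prop)]
  exact sg_homog ν hν h0 g hg R hR

lemma sg_meas_floor (c : ℝ) :
    Measurable fun (x : Fin 2 → ℝ) (i : Fin 2) => ⌊c * x i⌋ := by
  rw [measurable_pi_iff]; intro i
  exact Int.measurable_floor.comp (by fun_prop)

lemma sg_tsum_floor (G : (Fin 2 → ℤ) → ℝ≥0∞) (c : ℝ) (hc : 0 < c) :
    (ENNReal.ofReal (c ^ 2))⁻¹ * ∑' m, G m = ∫⁻ x : Fin 2 → ℝ, G (fun i => ⌊c * x i⌋) := by
  rw [← lintegral_map (f := G) (Measurable.of_discrete) (sg_meas_floor c), lintegral_countable',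
    ← ENNReal.tsum_mul_left]
  congr 1; ext m
  rw [Measure.map_apply (sg_meas_floor c) (measurableSet_singleton _)]
  have : (fun (x : Fin 2 → ℝ) (i : Fin 2) => ⌊c * x i⌋) ⁻¹' {m}
      = Set.univ.pi fun i => Set.Ico ((m i : ℝ) / c) (((m i : ℝ) + 1) / c) := by
    ext x
    simp only [Set.mem_preimage, Set.mem_singleton_iff, Set.mem_univ_pi, Set.mem_Ico, funext_iff,
      Int.floor_eq_iff]
    refine forall_congr' fun i => ?_
    rw [div_le_iff₀ hc, lt_div_iff₀ hc, mul_comm c]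
  rw [this, Real.volume_pi_Ico, Fin.prod_univ_two]
  have h2 : ∀ a : ℝ, (a + 1) / c - a / c = c⁻¹ := by intro a; field_simp; ring
  rw [h2, h2, ← ENNReal.ofReal_mul (by positivity), ← ENNReal.ofReal_inv_of_pos (by positivity),
    mul_comm]
  congr 2
  field_simp

lemma sg_riemann (f : (Fin 2 → ℝ) → ℝ) (hf : Continuous f) (hs : HasCompactSupport f)
    (v : Fin 2 → ℝ) (hv : ∀ i, |v i| ≤ 1) :
    Filter.Tendsto (fun n : ℕ => (ENNReal.ofReal (((n : ℝ) + 1) ^ 2))⁻¹ * ∑' m : Fin 2 → ℤ,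
        ENNReal.ofReal (f (((n : ℝ) + 1)⁻¹ • ((fun i => (m i : ℝ)) + v)))) Filter.atTop
      (nhds (∫⁻ x, ENNReal.ofReal (f x))) := by
  obtain ⟨C, hC⟩ := hs.exists_bound_of_continuous hf
  obtain ⟨K, hK⟩ := hs.isCompact.isBounded.subset_closedBall 0
  let u : ℕ → (Fin 2 → ℝ) → (Fin 2 → ℝ) := fun n x =>
    ((n : ℝ) + 1)⁻¹ • ((fun i => ((⌊((n : ℝ) + 1) * x i⌋ : ℤ) : ℝ)) + v)
  have hu : ∀ n x, ‖u n x - x‖ ≤ 2 * (1 / ((n : ℝ) + 1)) := by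
    intro n x
    rw [pi_norm_le_iff_of_nonneg (by positivity)]
    intro i
    have hn : (0 : ℝ) < (n : ℝ) + 1 := by positivity
    have e : (u n x - x) i = ((⌊((n : ℝ) + 1) * x i⌋ : ℝ) - ((n : ℝ) + 1) * x i + v i)
        * (1 / ((n : ℝ) + 1)) := by
      simp [u]; field_simp; ring
    rw [e, Real.norm_eq_abs, abs_mul, abs_of_pos (show 0 < 1 / ((n : ℝ) + 1) by positivity)]
    refine mul_le_mul_of_nonneg_right ?_ (by positivity)
    have h1 := Int.floor_le (((n : ℝ) + 1) * x i)
    have h2 := Int.lt_floor_add_one (((n : ℝ) + 1) * x i)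
    have h3 := abs_le.mp (hv i)
    rw [abs_le]; constructor <;> linarith
  have hum : ∀ n, Measurable (u n) := by
    intro n
    rw [measurable_pi_iff]; intro i
    have : Measurable fun x : Fin 2 → ℝ => ((⌊((n : ℝ) + 1) * x i⌋ : ℤ) : ℝ) := by fun_prop
    simp only [u, Pi.smul_apply, Pi.add_apply]
    fun_prop
  have e1 : ∀ n : ℕ, (ENNReal.ofReal (((n : ℝ) + 1) ^ 2))⁻¹ * ∑' m : Fin 2 → ℤ,
        ENNReal.ofReal (f (((n : ℝ) + 1)⁻¹ • ((fun i => (m i : ℝ)) + v)))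
        = ∫⁻ x, ENNReal.ofReal (f (u n x)) := by
    intro n
    rw [sg_tsum_floor _ _ (by positivity)]
  simp_rw [e1]
  refine tendsto_lintegral_of_dominated_convergence
    ((Metric.closedBall 0 (K + 2)).indicator fun _ => ENNReal.ofReal C) ?_ ?_ ?_ ?_
  · intro n
    exact ENNReal.measurable_ofReal.comp (hf.measurable.comp (hum n))
  · intro n
    refine Filter.Eventually.of_forall fun x => ?_
    by_cases hx : f (u n x) = 0
    · simp [hx]
    · have h1 : u n x ∈ Metric.closedBall 0 K := hK (subset_tsupport f hx)
      have h2 : x ∈ Metric.closedBall (0 : Fin 2 → ℝ) (K + 2) := by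
        simp only [mem_closedBall_zero_iff] at h1 ⊢
        have h3 := hu n x
        have h4 : 1 / ((n : ℝ) + 1) ≤ 1 := by
          rw [div_le_one (by positivity)]; simp
        have h5 : ‖x‖ ≤ ‖u n x‖ + ‖u n x - x‖ := by
          have := norm_sub_le (u n x) (u n x - x)
          simpa using this
        linarith
      rw [Set.indicator_of_mem h2]
      exact ENNReal.ofReal_le_ofReal ((le_abs_self _).trans (hC _))
  · rw [lintegral_indicator measurableSet_closedBall]
    simp only [lintegral_const, Measure.restrict_apply MeasurableSet.univ, Set.univ_inter]
    exact ENNReal.mul_ne_top ENNReal.ofReal_ne_top (measure_closedBall_lt_top).ne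
  · refine Filter.Eventually.of_forall fun x => ?_
    have h1 : Filter.Tendsto (fun n => u n x) Filter.atTop (nhds x) := by
      rw [tendsto_iff_norm_sub_tendsto_zero]
      refine squeeze_zero (fun _ => norm_nonneg _) (fun n => hu n x) ?_
      simpa using (tendsto_one_div_add_atTop_nhds_zero_nat (𝕜 := ℝ)).const_mul 2
    exact ((ENNReal.continuous_ofReal.comp hf).tendsto x).comp h1

lemma sg_ind_le {α : Type*} (A : Set α) (m : α) (b : ℝ≥0∞) (h : m ∈ A → 1 ≤ b) :
    A.indicator (1 : α → ℝ≥0∞) m ≤ b := by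
  by_cases hm : m ∈ A
  · rw [Set.indicator_of_mem hm]; exact h hm
  · rw [Set.indicator_of_notMem hm]; exact zero_le

/-- Indicator of the open sup-norm ball of radius one half. -/
noncomputable def sgB : (Fin 2 → ℝ) → ℝ≥0∞ :=
  {p : Fin 2 → ℝ | ∀ i, |p i| < 1 / 2}.indicator 1

lemma sgB_meas : Measurable sgB := by
  refine measurable_one.indicator ?_
  have : {p : Fin 2 → ℝ | ∀ i, |p i| < 1 / 2} = ⋂ i, {p : Fin 2 → ℝ | |p i| < 1 / 2} := by
    ext; simp
  rw [this]
  refine MeasurableSet.iInter fun i => ?_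
  exact measurableSet_lt (by fun_prop) (by fun_prop)

/-- Integer vectors as real vectors. -/
def sgCast (m : Fin 2 → ℤ) : Fin 2 → ℝ := fun i => (m i : ℝ)

lemma sgCast_inj : Function.Injective sgCast := by
  intro a b h; ext i
  have := congrFun h i
  simpa [sgCast] using this

lemma sgCast_vecMul (m : Fin 2 → ℤ) (a : Matrix (Fin 2) (Fin 2) ℤ) :
    Matrix.vecMul (sgCast m) (a.map (Int.cast : ℤ → ℝ)) = sgCast (Matrix.vecMul m a) := by
  ext i; simp [sgCast, Matrix.vecMul, dotProduct, Fin.sum_univ_two]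

/-- Number of integer vectors mapped to the small ball. -/
noncomputable def sgN (M : Matrix (Fin 2) (Fin 2) ℝ) : ℝ≥0∞ :=
  ∑' m : Fin 2 → ℤ, sgB (Matrix.vecMul (sgCast m) M)

/-- Coprime integer vectors. -/
abbrev SgPrim := {m : Fin 2 → ℤ // IsCoprime (m 0) (m 1)}

lemma sgPrim_inj : Function.Injective fun m : SgPrim => sgCast m.1 :=
  sgCast_inj.comp Subtype.val_injective

lemma sgPrim_pm (m m' : SgPrim) (h : m.1 0 * m'.1 1 = m.1 1 * m'.1 0) :
    m'.1 = m.1 ∨ m'.1 = -m.1 := by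
  obtain ⟨m, a, b, hab⟩ := m
  obtain ⟨m', hm'⟩ := m'
  simp only at *
  have h0 : m' 0 = m 0 * (a * m' 0 + b * m' 1) := by linear_combination (-m' 0) * hab - b * h
  have h1 : m' 1 = m 1 * (a * m' 0 + b * m' 1) := by linear_combination (-m' 1) * hab + a * h
  have hu := hm'.isUnit_of_dvd' (Dvd.intro_left _ h0.symm) (Dvd.intro_left _ h1.symm)
  rcases Int.isUnit_iff.mp hu with hk | hk
  · left; rw [hk] at h0 h1; ext i; fin_cases i <;> simp <;> linarith
  · right; rw [hk] at h0 h1; ext i; fin_cases i <;> simp <;> linarith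

lemma sgPrim_le (M : Matrix (Fin 2) (Fin 2) ℝ) (hM : M.det = 1) :
    ∑' m : SgPrim, sgB (Matrix.vecMul (sgCast m.1) M) ≤ 2 := by
  classical
  by_cases hex : ∃ m : SgPrim, ∀ i, |Matrix.vecMul (sgCast m.1) M i| < 1 / 2
  · obtain ⟨m, hm⟩ := hex
    let m2 : SgPrim := ⟨-m.1, by simpa using m.2.neg_neg⟩
    rw [tsum_eq_sum (s := {m, m2})]
    · refine (Finset.sum_le_card_nsmul _ _ 1 ?_).trans ?_
      · intro x _
        unfold sgB
        exact Set.indicator_le_self' (by simp) _ |>.trans (by simp)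
      · rw [nsmul_eq_mul, mul_one]
        exact_mod_cast Finset.card_le_two
    · intro x hx
      unfold sgB
      apply Set.indicator_of_notMem
      intro hxB
      apply hx
      have hxB' : ∀ i, |Matrix.vecMul (sgCast x.1) M i| < 1 / 2 := hxB
      have hd : m.1 0 * x.1 1 = m.1 1 * x.1 0 := by
        have e : ((m.1 0 * x.1 1 - m.1 1 * x.1 0 : ℤ) : ℝ) =
            Matrix.vecMul (sgCast m.1) M 0 * Matrix.vecMul (sgCast x.1) M 1 -
            Matrix.vecMul (sgCast m.1) M 1 * Matrix.vecMul (sgCast x.1) M 0 := by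
          rw [Matrix.det_fin_two] at hM
          simp only [sgCast, Matrix.vecMul, dotProduct, Fin.sum_univ_two]
          push_cast
          linear_combination (-((m.1 0 : ℝ) * x.1 1 - m.1 1 * x.1 0)) * hM
        have hb : ∀ a b : ℝ, |a| < 1 / 2 → |b| < 1 / 2 → |a * b| < 1 / 4 := by
          intro a b ha hb
          rw [abs_mul]
          nlinarith [abs_nonneg a, abs_nonneg b]
        have h1 := abs_lt.mp (hb _ _ (hm 0) (hxB' 1))
        have h2 := abs_lt.mp (hb _ _ (hm 1) (hxB' 0))
        have h3 : ((m.1 0 * x.1 1 - m.1 1 * x.1 0 : ℤ) : ℝ) < 1 := by rw [e]; linarith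
        have h4 : (-1 : ℝ) < ((m.1 0 * x.1 1 - m.1 1 * x.1 0 : ℤ) : ℝ) := by rw [e]; linarith
        have h3' : m.1 0 * x.1 1 - m.1 1 * x.1 0 < 1 := by exact_mod_cast h3
        have h4' : -1 < m.1 0 * x.1 1 - m.1 1 * x.1 0 := by exact_mod_cast h4
        omega
      rcases sgPrim_pm m x hd with h | h
      · simp [Subtype.ext h]
      · have : x = m2 := Subtype.ext h
        simp [this]
  · push Not at hex
    have : ∀ m : SgPrim, sgB (Matrix.vecMul (sgCast m.1) M) = 0 := by
      intro m
      unfold sgB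
      apply Set.indicator_of_notMem
      intro hB
      obtain ⟨i, hi⟩ := hex m
      exact absurd (hB i) (not_lt.mpr hi)
    simp [this]

lemma sgN_le (M : Matrix (Fin 2) (Fin 2) ℝ) :
    sgN M ≤ 1 + ∑' k : ℕ, ∑' m : SgPrim,
      sgB (((k : ℝ) + 1) • Matrix.vecMul (sgCast m.1) M) := by
  let ψ : Unit ⊕ (ℕ × SgPrim) → (Fin 2 → ℤ) :=
    Sum.elim (fun _ => 0) (fun q => ((q.1 : ℤ) + 1) • q.2.1)
  have hψ : Function.Surjective ψ := by
    intro m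
    by_cases hm : m = 0
    · exact ⟨Sum.inl (), by simp [ψ, hm]⟩
    · have hg : 0 < Int.gcd (m 0) (m 1) := by
        rw [Nat.pos_iff_ne_zero]
        intro h
        rw [Int.gcd_eq_zero_iff] at h
        apply hm; ext i; fin_cases i <;> simp [h.1, h.2]
      obtain ⟨k, hk⟩ : ∃ k, Int.gcd (m 0) (m 1) = k + 1 := ⟨_, (Nat.succ_pred_eq_of_pos hg).symm⟩
      refine ⟨Sum.inr (k, ⟨![m 0 / (Int.gcd (m 0) (m 1) : ℤ), m 1 / (Int.gcd (m 0) (m 1) : ℤ)], ?_⟩), ?_⟩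
      · rw [Int.isCoprime_iff_gcd_eq_one]
        simpa using Int.gcd_div_gcd_div_gcd hg
      · have hk' : (k : ℤ) + 1 = (Int.gcd (m 0) (m 1) : ℤ) := by rw [hk]; simp
        ext i
        fin_cases i
        · simp [ψ, hk', Int.mul_ediv_cancel' (Int.gcd_dvd_left _ _)]
        · simp [ψ, hk', Int.mul_ediv_cancel' (Int.gcd_dvd_right _ _)]
  unfold sgN
  refine (ENNReal.tsum_le_tsum_comp_of_surjective hψ _).trans ?_
  rw [ENNReal.summable.tsum_sum ENNReal.summable, ← ENNReal.tsum_prod]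
  gcongr with q
  · simp only [tsum_fintype]
    simp only [Finset.univ_unique, Finset.sum_singleton]
    unfold sgB
    exact Set.indicator_le_self' (by simp) _ |>.trans (by simp)
  · apply le_of_eq
    congr 1
    rw [← Matrix.smul_vecMul]
    congr 1
    ext i
    simp [ψ, sgCast]

lemma sgN_fin (μ₀ : Measure (Matrix (Fin 2) (Fin 2) ℝ)) [IsProbabilityMeasure μ₀]
    (hdet : ∀ᵐ M ∂μ₀, M.det = 1)
    (hinv : ∀ h : Matrix (Fin 2) (Fin 2) ℝ, h.det = 1 →
      ∀ F : Matrix (Fin 2) (Fin 2) ℝ → ℝ≥0∞, Measurable F →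
        (∀ γ, inGamma20 γ → ∀ M, F (γ * M) = F M) →
        ∫⁻ M, F (M * h) ∂μ₀ = ∫⁻ M, F M ∂μ₀) :
    ∫⁻ M, sgN M ∂μ₀ ≠ ⊤ := by
  set P : Set (Fin 2 → ℝ) := Set.range fun m : SgPrim => sgCast m.1 with hP
  have hPc : P.Countable := Set.countable_range _
  have hth : ∀ g M, sgTheta P g M = ∑' m : SgPrim, g (Matrix.vecMul (sgCast m.1) M) := by
    intro g M
    exact tsum_range (fun w => g (Matrix.vecMul w M)) sgPrim_inj
  have hP0 : (0 : Fin 2 → ℝ) ∉ P := by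
    rintro ⟨m, hm⟩
    have h1 : m.1 = 0 := sgCast_inj (hm.trans (by ext; simp [sgCast]))
    have := m.2
    rw [h1] at this
    exact not_isCoprime_zero_zero this
  have hPi : ∀ γ, inGamma20 γ → ∀ w ∈ P, Matrix.vecMul w γ ∈ P := by
    rintro _ ⟨a, rfl, hd, -⟩ _ ⟨m, rfl⟩
    exact ⟨⟨Matrix.vecMul m.1 a, IsCoprime.vecMulSL m.2 ⟨a, hd⟩⟩, (sgCast_vecMul _ _).symm⟩
  have hI : ∫⁻ M, sgTheta P sgB M ∂μ₀ ≤ 2 := by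
    calc ∫⁻ M, sgTheta P sgB M ∂μ₀ ≤ ∫⁻ _, 2 ∂μ₀ := by
          apply lintegral_mono_ae
          filter_upwards [hdet] with M hM
          rw [hth]; exact sgPrim_le M hM
      _ = 2 := by simp
  have hle : ∫⁻ M, sgN M ∂μ₀ ≤ 1 + ∑' k : ℕ, ENNReal.ofReal (((k : ℝ) + 1)⁻¹ ^ 2) * 2 := by
    calc ∫⁻ M, sgN M ∂μ₀ ≤ ∫⁻ M, 1 + ∑' k : ℕ,
            sgTheta P (fun p => sgB ((((k : ℝ) + 1)⁻¹)⁻¹ • p)) M ∂μ₀ := by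
          refine lintegral_mono fun M => ?_
          simp only [hth, inv_inv]
          exact sgN_le M
      _ = 1 + ∑' k : ℕ, ∫⁻ M, sgTheta P (fun p => sgB ((((k : ℝ) + 1)⁻¹)⁻¹ • p)) M ∂μ₀ := by
          rw [lintegral_add_left measurable_const, lintegral_tsum]
          · simp
          · intro k
            exact (sgTheta_meas P hPc _ (sgB_meas.comp (by fun_prop))).aemeasurable
      _ ≤ _ := by
          gcongr with k
          rw [sgTheta_homog μ₀ hdet hinv P hPc hP0 hPi sgB sgB_meas _ (by positivity)]
          gcongr
  refine ne_top_of_le_ne_top ?_ hle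
  rw [ENNReal.tsum_mul_right]
  refine ENNReal.add_ne_top.mpr ⟨by simp, ENNReal.mul_ne_top ?_ (by simp)⟩
  have hs : Summable fun k : ℕ => ((k : ℝ) + 1)⁻¹ ^ 2 := by
    have := (summable_nat_add_iff 1).mpr (Real.summable_nat_pow_inv.mpr (show 1 < 2 by norm_num))
    simpa using this
  rw [← ENNReal.ofReal_tsum_of_nonneg (fun _ => by positivity) hs]
  simp

lemma sg_cell (v : Fin 2 → ℝ) (M : Matrix (Fin 2) (Fin 2) ℝ) (c : Fin 2 → ℤ) :
    ∑' m : Fin 2 → ℤ, {m : Fin 2 → ℤ | ∀ i, ⌊2 * Matrix.vecMul (sgCast m + v) M i⌋ = c i}.indicator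
      (1 : (Fin 2 → ℤ) → ℝ≥0∞) m ≤ sgN M := by
  by_cases hex : ∃ m : Fin 2 → ℤ, ∀ i, ⌊2 * Matrix.vecMul (sgCast m + v) M i⌋ = c i
  · obtain ⟨m₀, h₀⟩ := hex
    unfold sgN
    rw [← (Equiv.subRight m₀).tsum_eq (fun m => sgB (Matrix.vecMul (sgCast m) M))]
    refine ENNReal.tsum_le_tsum fun m => ?_
    refine sg_ind_le _ _ _ fun hm => ?_
    unfold sgB
    rw [Set.indicator_of_mem]
    · simp
    intro i
    have h1 := Int.floor_eq_iff.mp (hm i)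
    have h2 := Int.floor_eq_iff.mp (h₀ i)
    have e : sgCast (Equiv.subRight m₀ m) = (sgCast m + v) - (sgCast m₀ + v) := by
      ext i; simp [sgCast]
    rw [e, Matrix.sub_vecMul, Pi.sub_apply, abs_lt]
    constructor <;> linarith
  · push Not at hex
    have : {m : Fin 2 → ℤ | ∀ i, ⌊2 * Matrix.vecMul (sgCast m + v) M i⌋ = c i} = ∅ := by
      ext m
      simp only [Set.mem_ofPred_eq, Set.mem_empty_iff_false, iff_false, not_forall]
      exact hex m
    rw [this]; simp

lemma sg_count (v : Fin 2 → ℝ) (M : Matrix (Fin 2) (Fin 2) ℝ) (S : ℕ) :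
    ∑' m : Fin 2 → ℤ, {m : Fin 2 → ℤ | ∀ i, |Matrix.vecMul (sgCast m + v) M i| ≤ S}.indicator
      (1 : (Fin 2 → ℤ) → ℝ≥0∞) m ≤ ((4 * S + 1) ^ 2 : ℕ) * sgN M := by
  let T : Finset (Fin 2 → ℤ) := Fintype.piFinset fun _ => Finset.Icc (-(2 * S : ℤ)) (2 * S)
  have hT : T.card = (4 * S + 1) ^ 2 := by
    simp only [T, Fintype.card_piFinset, Fin.prod_univ_two, Int.card_Icc]
    rw [← sq]; congr 1; omega
  calc _ ≤ ∑' m : Fin 2 → ℤ, ∑ c ∈ T,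
        {m : Fin 2 → ℤ | ∀ i, ⌊2 * Matrix.vecMul (sgCast m + v) M i⌋ = c i}.indicator
        (1 : (Fin 2 → ℤ) → ℝ≥0∞) m := by
        refine ENNReal.tsum_le_tsum fun m => ?_
        refine sg_ind_le _ _ _ fun hm => ?_
        have hc : (fun i => ⌊2 * Matrix.vecMul (sgCast m + v) M i⌋) ∈ T := by
          simp only [T, Fintype.mem_piFinset, Finset.mem_Icc]
          intro i
          have h := abs_le.mp (hm i)
          constructor
          · rw [Int.le_floor]; push_cast; linarith
          · have h1 := Int.floor_le (2 * Matrix.vecMul (sgCast m + v) M i)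
            have : ((⌊2 * Matrix.vecMul (sgCast m + v) M i⌋ : ℤ) : ℝ) ≤ ((2 * S : ℤ) : ℝ) := by
              push_cast; linarith
            exact_mod_cast this
        refine le_trans ?_ (Finset.single_le_sum (fun _ _ => zero_le) hc)
        rw [Set.indicator_of_mem]
        · simp
        · intro i; rfl
    _ = ∑ c ∈ T, ∑' m : Fin 2 → ℤ,
        {m : Fin 2 → ℤ | ∀ i, ⌊2 * Matrix.vecMul (sgCast m + v) M i⌋ = c i}.indicator
        (1 : (Fin 2 → ℤ) → ℝ≥0∞) m := Summable.tsum_finsetSum fun _ _ => ENNReal.summable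
    _ ≤ T.card • sgN M := Finset.sum_le_card_nsmul _ _ _ fun c _ => sg_cell v M c
    _ = _ := by rw [hT, nsmul_eq_mul]

/-- The shift vector. -/
noncomputable def sgV : Fin 2 → ℝ := ![1 / 2, -1 / 4]

/-- The shifted lattice. -/
def sgL : Set (Fin 2 → ℝ) := Set.range fun m : Fin 2 → ℤ => sgCast m + sgV

lemma sgL_inj : Function.Injective fun m : Fin 2 → ℤ => sgCast m + sgV :=
  (add_left_injective sgV).comp sgCast_inj

lemma sgL_countable : sgL.Countable := Set.countable_range _

lemma sgL_theta (g : (Fin 2 → ℝ) → ℝ≥0∞) (M : Matrix (Fin 2) (Fin 2) ℝ) :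
    sgTheta sgL g M = ∑' m : Fin 2 → ℤ, g (Matrix.vecMul (sgCast m + sgV) M) :=
  tsum_range (fun w => g (Matrix.vecMul w M)) sgL_inj

lemma sgL_zero : (0 : Fin 2 → ℝ) ∉ sgL := by
  rintro ⟨m, hm⟩
  have h := congrFun hm 0
  simp [sgCast, sgV] at h
  have h2 : (2 * m 0 + 1 : ℤ) = 0 := by
    have : ((2 * m 0 + 1 : ℤ) : ℝ) = 0 := by push_cast; linarith
    exact_mod_cast this
  omega

lemma sgL_inv : ∀ γ, inGamma20 γ → ∀ w ∈ sgL, Matrix.vecMul w γ ∈ sgL := by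
  rintro _ ⟨a, rfl, -, hm⟩ _ ⟨m, rfl⟩
  have hz : ∀ z : ℤ, (z : ZMod 4) = 0 → ∃ x, z = 4 * x := by
    intro z h
    exact (ZMod.intCast_zmod_eq_zero_iff_dvd z 4).mp h
  have h00 : ∃ x, a 0 0 - 1 = 4 * x := by
    apply hz
    rcases hm with h | h <;> have := congrFun (congrFun h 0) 0 <;> simp at this <;> simp [this]
  have h10 : ∃ x, a 1 0 = 4 * x := by
    apply hz
    rcases hm with h | h <;> have := congrFun (congrFun h 1) 0 <;> simp at this <;> simp [this]
  have h11 : ∃ x, a 1 1 - 1 = 4 * x := by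
    apply hz
    rcases hm with h | h <;> have := congrFun (congrFun h 1) 1 <;> simp at this <;> simp [this]
  have h01 : ∃ x, 2 * a 0 1 = 4 * x := by
    apply hz
    rcases hm with h | h <;> have := congrFun (congrFun h 0) 1 <;> simp at this <;>
      push_cast <;> rw [this] <;> decide
  obtain ⟨x, hx⟩ := h00
  obtain ⟨y, hy⟩ := h10
  obtain ⟨z, hz'⟩ := h11
  obtain ⟨t, ht⟩ := h01
  refine ⟨Matrix.vecMul m a + ![2 * x - y, t - z], ?_⟩
  simp only []
  rw [Matrix.add_vecMul, sgCast_vecMul]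
  have e00 : (a 0 0 : ℝ) = 4 * x + 1 := by
    have : a 0 0 = 4 * x + 1 := by omega
    rw [this]; push_cast; ring
  have e10 : (a 1 0 : ℝ) = 4 * y := by rw [hy]; push_cast; ring
  have e11 : (a 1 1 : ℝ) = 4 * z + 1 := by
    have : a 1 1 = 4 * z + 1 := by omega
    rw [this]; push_cast; ring
  have e01 : (a 0 1 : ℝ) = 2 * t := by
    have : a 0 1 = 2 * t := by omega
    rw [this]; push_cast; ring
  have e : Matrix.vecMul sgV (a.map (Int.cast : ℤ → ℝ)) = sgCast ![2 * x - y, t - z] + sgV := by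
    ext i
    fin_cases i
    · simp only [sgV, Matrix.vecMul, dotProduct, Fin.sum_univ_two]
      simp [e00, e10, sgCast]; ring
    · simp only [sgV, Matrix.vecMul, dotProduct, Fin.sum_univ_two]
      simp [e01, e11, sgCast]; ring
  rw [e, ← add_assoc]
  congr 1
  ext i; simp [sgCast]

lemma sg_limit (f : (Fin 2 → ℝ) → ℝ) (hf : Continuous f) (hs : HasCompactSupport f)
    (M : Matrix (Fin 2) (Fin 2) ℝ) (hM : M.det = 1) :
    Filter.Tendsto (fun n : ℕ => (ENNReal.ofReal (((n : ℝ) + 1) ^ 2))⁻¹ *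
        sgTheta sgL (fun p => ENNReal.ofReal (f (((n : ℝ) + 1)⁻¹ • p))) M) Filter.atTop
      (nhds (∫⁻ x, ENNReal.ofReal (f x))) := by
  have hu : IsUnit M.det := by rw [hM]; exact isUnit_one
  have hcont : ∀ A : Matrix (Fin 2) (Fin 2) ℝ, Continuous fun x => Matrix.vecMul x A := by
    intro A
    refine continuous_pi fun i => ?_
    simp only [Matrix.vecMul, dotProduct, Fin.sum_univ_two]
    fun_prop
  have hs' : HasCompactSupport fun x => f (Matrix.vecMul x M) := by
    refine HasCompactSupport.intro (hs.isCompact.image (hcont M⁻¹)) ?_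
    intro x hx
    by_contra hne
    apply hx
    refine ⟨Matrix.vecMul x M, subset_tsupport f hne, ?_⟩
    simp [Matrix.vecMul_vecMul, Matrix.mul_nonsing_inv M hu]
  have h := sg_riemann _ (hf.comp (hcont M)) hs' sgV (by
    intro i; fin_cases i <;> simp [sgV, abs_le] <;> norm_num)
  have hI : ∫⁻ x, ENNReal.ofReal (f x) = ∫⁻ x, ENNReal.ofReal (f (Matrix.vecMul x M)) := by
    have hd : (M.transpose).det = 1 := by rw [Matrix.det_transpose, hM]
    have h1 := Real.map_matrix_volume_pi_eq_smul_volume_pi (M := M.transpose) (by rw [hd]; simp)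
    rw [hd] at h1
    simp only [inv_one, abs_one, ENNReal.ofReal_one, one_smul] at h1
    conv_lhs => rw [← h1]
    rw [lintegral_map]
    · simp [Matrix.toLin'_apply, Matrix.mulVec_transpose]
    · exact ENNReal.measurable_ofReal.comp hf.measurable
    · exact (LinearMap.continuous_of_finiteDimensional _).measurable
  rw [hI]
  refine h.congr fun n => ?_
  rw [sgL_theta]
  congr 2; ext m
  simp only [Function.comp]
  rw [Matrix.smul_vecMul]
  rfl

lemma sg_dom (f : (Fin 2 → ℝ) → ℝ) (hf : Continuous f) (hs : HasCompactSupport f) :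
    ∃ D : ℝ≥0∞, D ≠ ⊤ ∧ ∀ (n : ℕ) (M : Matrix (Fin 2) (Fin 2) ℝ),
      (ENNReal.ofReal (((n : ℝ) + 1) ^ 2))⁻¹ *
        sgTheta sgL (fun p => ENNReal.ofReal (f (((n : ℝ) + 1)⁻¹ • p))) M ≤ D * sgN M := by
  obtain ⟨C, hC⟩ := hs.exists_bound_of_continuous hf
  obtain ⟨K', hK'⟩ := hs.isCompact.isBounded.subset_closedBall 0
  obtain ⟨K, hK⟩ := exists_nat_ge K'
  refine ⟨ENNReal.ofReal C * ((4 * K + 1) ^ 2 : ℕ),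
    ENNReal.mul_ne_top ENNReal.ofReal_ne_top (ENNReal.natCast_ne_top _), fun n M => ?_⟩
  have hn : (0 : ℝ) < (n : ℝ) + 1 := by positivity
  rw [sgL_theta]
  have h1 : ∑' m : Fin 2 → ℤ, ENNReal.ofReal (f (((n : ℝ) + 1)⁻¹ •
      Matrix.vecMul (sgCast m + sgV) M)) ≤ ENNReal.ofReal C *
        (((4 * (K * (n + 1)) + 1) ^ 2 : ℕ) * sgN M) := by
    refine le_trans ?_ (mul_le_mul_right (sg_count sgV M (K * (n + 1))) _)
    rw [← ENNReal.tsum_mul_left]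
    refine ENNReal.tsum_le_tsum fun m => ?_
    by_cases hx : f (((n : ℝ) + 1)⁻¹ • Matrix.vecMul (sgCast m + sgV) M) = 0
    · rw [hx]; simp
    · have h2 := hK' (subset_tsupport f hx)
      rw [mem_closedBall_zero_iff] at h2
      rw [Set.indicator_of_mem]
      · simp only [Pi.one_apply, mul_one]
        exact ENNReal.ofReal_le_ofReal ((le_abs_self _).trans (hC _))
      · intro i
        have h3 := (norm_le_pi_norm _ i).trans (h2.trans hK)
        rw [Pi.smul_apply, smul_eq_mul, Real.norm_eq_abs, abs_mul, abs_of_pos (inv_pos.mpr hn),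
          inv_mul_le_iff₀ hn] at h3
        push_cast
        linarith
  rw [mul_comm, ← div_eq_mul_inv]
  refine ENNReal.div_le_of_le_mul ?_
  refine h1.trans ?_
  have h4 : (((4 * (K * (n + 1)) + 1) ^ 2 : ℕ) : ℝ≥0∞) ≤
      ((4 * K + 1) ^ 2 : ℕ) * ENNReal.ofReal (((n : ℝ) + 1) ^ 2) := by
    have e : ENNReal.ofReal (((n : ℝ) + 1) ^ 2) = (((n + 1) ^ 2 : ℕ) : ℝ≥0∞) := by
      rw [← ENNReal.ofReal_natCast]; push_cast; rfl
    rw [e, ← Nat.cast_mul, Nat.cast_le, ← mul_pow]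
    refine Nat.pow_le_pow_left ?_ 2
    nlinarith
  calc _ ≤ ENNReal.ofReal C * ((((4 * K + 1) ^ 2 : ℕ) * ENNReal.ofReal (((n : ℝ) + 1) ^ 2))
        * sgN M) := by gcongr
    _ = _ := by ring

lemma sg_main (μ₀ : Measure (Matrix (Fin 2) (Fin 2) ℝ)) [IsProbabilityMeasure μ₀]
    (hdet : ∀ᵐ M ∂μ₀, M.det = 1)
    (hinv : ∀ h : Matrix (Fin 2) (Fin 2) ℝ, h.det = 1 →
      ∀ F : Matrix (Fin 2) (Fin 2) ℝ → ℝ≥0∞, Measurable F →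
        (∀ γ, inGamma20 γ → ∀ M, F (γ * M) = F M) →
        ∫⁻ M, F (M * h) ∂μ₀ = ∫⁻ M, F M ∂μ₀)
    (f : (Fin 2 → ℝ) → ℝ) (hf : Continuous f) (hs : HasCompactSupport f) :
    ∫⁻ M, sgTheta sgL (fun p => ENNReal.ofReal (f p)) M ∂μ₀ = ∫⁻ x, ENNReal.ofReal (f x) := by
  obtain ⟨D, hD, hdom⟩ := sg_dom f hf hs
  have hfm : Measurable fun p => ENNReal.ofReal (f p) :=
    ENNReal.measurable_ofReal.comp hf.measurable
  have hfm' : ∀ n : ℕ, Measurable fun p => ENNReal.ofReal (f (((n : ℝ) + 1)⁻¹ • p)) := by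
    intro n
    exact hfm.comp (by fun_prop : Measurable fun p : Fin 2 → ℝ => ((n : ℝ) + 1)⁻¹ • p)
  have hlim := tendsto_lintegral_of_dominated_convergence (μ := μ₀)
    (F := fun (n : ℕ) M => (ENNReal.ofReal (((n : ℝ) + 1) ^ 2))⁻¹ *
        sgTheta sgL (fun p => ENNReal.ofReal (f (((n : ℝ) + 1)⁻¹ • p))) M)
    (f := fun _ => ∫⁻ x, ENNReal.ofReal (f x)) (fun M => D * sgN M)
    (fun n => (sgTheta_meas sgL sgL_countable _ (hfm' n)).const_mul _)
    (fun n => Filter.Eventually.of_forall (hdom n))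
    (by
      rw [lintegral_const_mul' _ _ hD]
      exact ENNReal.mul_ne_top hD (sgN_fin μ₀ hdet hinv))
    (by
      filter_upwards [hdet] with M hM
      exact sg_limit f hf hs M hM)
  have hconst : ∀ n : ℕ, ∫⁻ M, (ENNReal.ofReal (((n : ℝ) + 1) ^ 2))⁻¹ *
        sgTheta sgL (fun p => ENNReal.ofReal (f (((n : ℝ) + 1)⁻¹ • p))) M ∂μ₀
      = ∫⁻ M, sgTheta sgL (fun p => ENNReal.ofReal (f p)) M ∂μ₀ := by
    intro n
    have hp : (0 : ℝ) < ((n : ℝ) + 1) ^ 2 := by positivity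
    rw [lintegral_const_mul _ (sgTheta_meas sgL sgL_countable _ (hfm' n)),
      sgTheta_homog μ₀ hdet hinv sgL sgL_countable sgL_zero sgL_inv _ hfm _ (by positivity),
      ← mul_assoc, ENNReal.inv_mul_cancel (ENNReal.ofReal_pos.mpr hp).ne' ENNReal.ofReal_ne_top, one_mul]
  simp only [hconst] at hlim
  have := tendsto_nhds_unique hlim tendsto_const_nhds
  simpa using this.symm

/-- Siegel integral formula for the shifted lattice `ℤ² + (1/2,-1/4)`: for `f ∈ C_c(ℝ²)`,
`∫_{Y₀} Σ_{m∈ℤ²} f((m + (1/2,-1/4))·M) dμ₀(M) = ∫_{ℝ²} f(x) dx`, where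
`Y₀ = Γ_{2,0}(4)\SL(2,ℝ)` and `μ₀` is the `SL(2,ℝ)`-invariant probability measure on `Y₀`,
encoded here as a probability measure on matrices, supported on `SL(2,ℝ)`, whose integral
of every `Γ_{2,0}(4)`-invariant measurable function is invariant under right translation. -/
theorem stmt14 (μ₀ : Measure (Matrix (Fin 2) (Fin 2) ℝ)) [IsProbabilityMeasure μ₀]
    (hdet : ∀ᵐ M ∂μ₀, M.det = 1)
    (hinv : ∀ h : Matrix (Fin 2) (Fin 2) ℝ, h.det = 1 →
      ∀ F : Matrix (Fin 2) (Fin 2) ℝ → ℝ≥0∞, Measurable F →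
        (∀ γ, inGamma20 γ → ∀ M, F (γ * M) = F M) →
        ∫⁻ M, F (M * h) ∂μ₀ = ∫⁻ M, F M ∂μ₀)
    (f : (Fin 2 → ℝ) → ℝ) (hf : Continuous f) (hsupp : HasCompactSupport f) :
    ∫ M, ∑' m : Fin 2 → ℤ,
        f (Matrix.vecMul ((fun i => (m i : ℝ)) + ![1/2, -1/4]) M) ∂μ₀
      = ∫ x, f x := by
  have hint : Integrable f := hf.integrable_of_hasCompactSupport hsupp
  have hp := sg_main μ₀ hdet hinv f hf hsupp
  have hn := sg_main μ₀ hdet hinv (fun x => -f x) hf.neg hsupp.neg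
  have hpf : ∫⁻ x, ENNReal.ofReal (f x) ≠ ⊤ := hint.lintegral_lt_top.ne
  have hnf : ∫⁻ x, ENNReal.ofReal (-f x) ≠ ⊤ := hint.neg.lintegral_lt_top.ne
  have hpm := sgTheta_meas sgL sgL_countable (fun p => ENNReal.ofReal (f p))
    (ENNReal.measurable_ofReal.comp hf.measurable)
  have hnm := sgTheta_meas sgL sgL_countable (fun p => ENNReal.ofReal (-f p))
    (ENNReal.measurable_ofReal.comp hf.neg.measurable)
  have hpa := ae_lt_top hpm (by rw [hp]; exact hpf)
  have hna := ae_lt_top hnm (by rw [hn]; exact hnf)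
  rw [integral_eq_lintegral_pos_part_sub_lintegral_neg_part hint, ← hp, ← hn,
    ← integral_toReal hpm.aemeasurable hpa, ← integral_toReal hnm.aemeasurable hna,
    ← integral_sub (integrable_toReal_of_lintegral_ne_top hpm.aemeasurable (by rw [hp]; exact hpf))
      (integrable_toReal_of_lintegral_ne_top hnm.aemeasurable (by rw [hn]; exact hnf))]
  apply integral_congr_ae
  filter_upwards [hpa, hna] with M h1 h2
  rw [sgL_theta] at h1 h2 ⊢
  rw [sgL_theta, ENNReal.tsum_toReal_eq (fun m => ENNReal.ofReal_ne_top),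
    ENNReal.tsum_toReal_eq (fun m => ENNReal.ofReal_ne_top),
    ← (ENNReal.summable_toReal h1.ne).tsum_sub (ENNReal.summable_toReal h2.ne)]
  congr 1; ext m
  simp only [ENNReal.toReal_ofReal']
  change f (Matrix.vecMul (sgCast m + sgV) M) = _
  generalize f (Matrix.vecMul (sgCast m + sgV) M) = y
  rcases le_total 0 y with h | h
  · rw [max_eq_left h, max_eq_right (by linarith)]; ring
  · rw [max_eq_right h, max_eq_left (by linarith)]; ring
end
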